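/- arXiv:1505.06517 — 4 statements merged into one kernel-verified Lean document; each statement's English description precedes it below -/
import Mathlib

section
/- Let p : ℕ → ℝ be strictly positive and let u : ℕ → ℂ be such that the series ∑_{l=1}^∞ p(l)|(Δu)(l)|² converges. Then for all natural numbers m ≥ n ≥ 1, |u(m)| ≤ |u(n)| + (∑_{l=1}^∞ p(l)|(Δu)(l)|²)^{1/2} · (∑_{l=n}^{m−1} 1/p(l))^{1/2}. -/
/-- If `p > 0` and `∑_{l=1}^∞ p(l)|(Δu)(l)|²` converges, then for `m ≥ n ≥ 1`,
`|u(m)| ≤ |u(n)| + (∑_{l=1}^∞ p(l)|(Δu)(l)|²)^{1/2} (∑_{l=n}^{m−1} 1/p(l))^{1/2}`. -/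
theorem pointwise_bound (p : ℕ → ℝ) (hp : ∀ l, 0 < p l) (u : ℕ → ℂ)
    (hsum : Summable (fun l : ℕ => p (l + 1) * ‖u (l + 2) - u (l + 1)‖ ^ 2))
    (m n : ℕ) (hn : 1 ≤ n) (hnm : n ≤ m) :
    ‖u m‖ ≤ ‖u n‖
      + Real.sqrt (∑' l : ℕ, p (l + 1) * ‖u (l + 2) - u (l + 1)‖ ^ 2)
        * Real.sqrt (∑ l ∈ Finset.Ico n m, 1 / p l) := by
  obtain ⟨k, rfl⟩ := Nat.exists_eq_add_of_le' hn
  obtain ⟨j, rfl⟩ := Nat.exists_eq_add_of_le' (hn.trans hnm)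
  have htail : ∑ l ∈ Finset.Ico (k + 1) (j + 1), p l * ‖u (l + 1) - u l‖ ^ 2
      ≤ ∑' l : ℕ, p (l + 1) * ‖u (l + 2) - u (l + 1)‖ ^ 2 := by
    rw [← Finset.sum_Ico_add' (fun l => p l * ‖u (l + 1) - u l‖ ^ 2) k j 1]
    exact hsum.sum_le_tsum _ fun l _ => mul_nonneg (hp _).le (sq_nonneg _)
  calc ‖u (j + 1)‖
      ≤ ‖u (k + 1)‖ + ‖u (j + 1) - u (k + 1)‖ := norm_le_norm_add_norm_sub' _ _
    _ ≤ ‖u (k + 1)‖ + ∑ l ∈ Finset.Ico (k + 1) (j + 1), ‖u (l + 1) - u l‖ := by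
        gcongr
        simpa only [dist_eq_norm'] using dist_le_Ico_sum_dist u hnm
    _ = ‖u (k + 1)‖ + ∑ l ∈ Finset.Ico (k + 1) (j + 1),
          √(p l * ‖u (l + 1) - u l‖ ^ 2) * √(1 / p l) := by
        congr 1
        refine Finset.sum_congr rfl fun l _ => ?_
        have hl := (hp l).ne'
        rw [← Real.sqrt_mul (mul_nonneg (hp l).le (sq_nonneg _)),
          show p l * ‖u (l + 1) - u l‖ ^ 2 * (1 / p l) = ‖u (l + 1) - u l‖ ^ 2 by field_simp,
          Real.sqrt_sq (norm_nonneg _)]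
    _ ≤ ‖u (k + 1)‖ + √(∑ l ∈ Finset.Ico (k + 1) (j + 1), p l * ‖u (l + 1) - u l‖ ^ 2)
          * √(∑ l ∈ Finset.Ico (k + 1) (j + 1), 1 / p l) := by
        gcongr
        exact Real.sum_sqrt_mul_sqrt_le _
          (fun l => mul_nonneg (hp l).le (sq_nonneg _)) fun l => (one_div_pos.mpr (hp l)).le
    _ ≤ _ := by gcongr
end

section
/- Let p : ℕ → ℝ be strictly positive, let q : ℕ → ℝ be nonnegative, and let u : ℕ → ℂ be such that ∑_{l=1}^∞ p(l)|(Δu)(l)|² converges. Let r ≥ 1 satisfy ∑_{n=1}^{r} q(n) > 0 and set C_r = (∑_{l=1}^{r} 1/p(l))^{1/2}. Then for every m with 1 ≤ m ≤ r, |u(m)| · ∑_{n=1}^{r} q(n) ≤ (∑_{n=1}^{r} q(n))^{1/2} · (∑_{n=1}^{r} q(n)|u(n)|²)^{1/2} + C_r · (∑_{l=1}^∞ p(l)|(Δu)(l)|²)^{1/2} · ∑_{n=1}^{r} q(n). -/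
/-- Discrete oscillation bound: two values of a sequence with indices in `[1, r]` differ by at most
the total variation of the sequence over `[1, r]`. -/
lemma norm_sub_le_sum_Icc {E : Type*} [SeminormedAddCommGroup E] (u : ℕ → E) {r m n : ℕ}
    (hm1 : 1 ≤ m) (hmr : m ≤ r) (hn1 : 1 ≤ n) (hnr : n ≤ r) :
    ‖u m - u n‖ ≤ ∑ l ∈ Finset.Icc 1 r, ‖u (l + 1) - u l‖ := by
  wlog h : n ≤ m generalizing m n
  · rw [norm_sub_rev]
    exact this hn1 hnr hm1 hmr (le_of_not_ge h)
  rw [norm_sub_rev, ← dist_eq_norm]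
  refine (dist_le_Ico_sum_dist u h).trans ?_
  simp_rw [dist_comm (u _) (u (_ + 1)), dist_eq_norm]
  refine Finset.sum_le_sum_of_subset_of_nonneg (fun l hl => ?_) fun _ _ _ => norm_nonneg _
  rw [Finset.mem_Ico] at hl
  rw [Finset.mem_Icc]
  omega

/-- Cauchy–Schwarz bound of the total variation by the weighted energy. -/
lemma sum_norm_sub_le_sqrt_mul_sqrt {E : Type*} [SeminormedAddCommGroup E] (u : ℕ → E)
    {p : ℕ → ℝ} (hp : ∀ l, 0 < p l) (s : Finset ℕ) :
    ∑ l ∈ s, ‖u (l + 1) - u l‖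
      ≤ Real.sqrt (∑ l ∈ s, 1 / p l) * Real.sqrt (∑ l ∈ s, p l * ‖u (l + 1) - u l‖ ^ 2) := by
  refine le_of_eq_of_le (Finset.sum_congr rfl fun l _ => ?_)
    (Real.sum_sqrt_mul_sqrt_le s (fun l => (one_div_pos.2 (hp l)).le)
      fun l => mul_nonneg (hp l).le (sq_nonneg _))
  rw [← Real.sqrt_mul (one_div_pos.2 (hp l)).le, ← mul_assoc, one_div_mul_cancel (hp l).ne',
    one_mul, Real.sqrt_sq (norm_nonneg _)]

/-- Cauchy–Schwarz for a weighted sum of nonnegative numbers. -/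
lemma sum_mul_le_sqrt_mul_sqrt_weighted {ι : Type*} {q a : ι → ℝ} (hq : ∀ n, 0 ≤ q n)
    (ha : ∀ n, 0 ≤ a n) (s : Finset ι) :
    ∑ n ∈ s, q n * a n ≤ Real.sqrt (∑ n ∈ s, q n) * Real.sqrt (∑ n ∈ s, q n * a n ^ 2) := by
  refine le_of_eq_of_le (Finset.sum_congr rfl fun n _ => ?_)
    (Real.sum_sqrt_mul_sqrt_le s hq fun n => mul_nonneg (hq n) (sq_nonneg _))
  rw [Real.sqrt_mul (hq n), Real.sqrt_sq (ha n), ← mul_assoc, Real.mul_self_sqrt (hq n)]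


/-- Lemma 2 of the paper: if `∑_{n=1}^r q(n) > 0` and `C_r = (∑_{l=1}^r 1/p(l))^{1/2}`,
then for `1 ≤ m ≤ r`,
`|u(m)| ∑_{n=1}^r q(n) ≤ (∑_{n=1}^r q(n))^{1/2} (∑_{n=1}^r q(n)|u(n)|²)^{1/2}
  + C_r (∑_{l=1}^∞ p(l)|(Δu)(l)|²)^{1/2} ∑_{n=1}^r q(n)`. -/
theorem weighted_pointwise_bound (p : ℕ → ℝ) (hp : ∀ l, 0 < p l)
    (q : ℕ → ℝ) (hq : ∀ n, 0 ≤ q n) (u : ℕ → ℂ)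
    (hsum : Summable (fun l : ℕ => p (l + 1) * ‖u (l + 2) - u (l + 1)‖ ^ 2))
    (r : ℕ) (hr : 1 ≤ r) (hqr : 0 < ∑ n ∈ Finset.Icc 1 r, q n)
    (m : ℕ) (hm1 : 1 ≤ m) (hmr : m ≤ r) :
    ‖u m‖ * ∑ n ∈ Finset.Icc 1 r, q n
      ≤ Real.sqrt (∑ n ∈ Finset.Icc 1 r, q n)
          * Real.sqrt (∑ n ∈ Finset.Icc 1 r, q n * ‖u n‖ ^ 2)
        + Real.sqrt (∑ l ∈ Finset.Icc 1 r, 1 / p l)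
          * Real.sqrt (∑' l : ℕ, p (l + 1) * ‖u (l + 2) - u (l + 1)‖ ^ 2)
          * ∑ n ∈ Finset.Icc 1 r, q n := by
  have henergy : ∑ l ∈ Finset.Icc 1 r, p l * ‖u (l + 1) - u l‖ ^ 2
      ≤ ∑' l : ℕ, p (l + 1) * ‖u (l + 2) - u (l + 1)‖ ^ 2 := by
    rw [← Finset.Ico_add_one_right_eq_Icc, Finset.sum_Ico_eq_sum_range]
    simp_rw [add_comm 1]
    exact hsum.sum_le_tsum _ fun l _ => mul_nonneg (hp _).le (sq_nonneg _)
  set D := Real.sqrt (∑ l ∈ Finset.Icc 1 r, 1 / p l)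
    * Real.sqrt (∑' l : ℕ, p (l + 1) * ‖u (l + 2) - u (l + 1)‖ ^ 2)
  have hosc : ∀ n ∈ Finset.Icc 1 r, ‖u m‖ ≤ ‖u n‖ + D := fun n hn => by
    rw [Finset.mem_Icc] at hn
    calc ‖u m‖ ≤ ‖u n‖ + ‖u m - u n‖ := norm_le_norm_add_norm_sub' _ _
      _ ≤ ‖u n‖ + D := by
        gcongr
        exact (norm_sub_le_sum_Icc u hm1 hmr hn.1 hn.2).trans <|
          (sum_norm_sub_le_sqrt_mul_sqrt u hp _).trans <|
            mul_le_mul_of_nonneg_left (Real.sqrt_le_sqrt henergy) (Real.sqrt_nonneg _)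
  calc ‖u m‖ * ∑ n ∈ Finset.Icc 1 r, q n
      = ∑ n ∈ Finset.Icc 1 r, q n * ‖u m‖ := by rw [mul_comm, Finset.sum_mul]
    _ ≤ ∑ n ∈ Finset.Icc 1 r, q n * (‖u n‖ + D) :=
      Finset.sum_le_sum fun n hn => mul_le_mul_of_nonneg_left (hosc n hn) (hq n)
    _ = ∑ n ∈ Finset.Icc 1 r, q n * ‖u n‖ + D * ∑ n ∈ Finset.Icc 1 r, q n := by
      simp_rw [mul_add]
      rw [Finset.sum_add_distrib, ← Finset.sum_mul, mul_comm D]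
    _ ≤ _ := by
      gcongr
      exact sum_mul_le_sqrt_mul_sqrt_weighted hq (fun n => norm_nonneg (u n)) _
end

section
/- Let p : ℕ → ℝ be strictly positive and let q : ℕ → ℝ be nonnegative and not identically zero on the positive integers (i.e., there exists k ≥ 1 with q(k) > 0). Then for every N ≥ 1 there exists a constant C_N > 0 such that for every u : ℕ → ℂ with ‖u‖² := ∑_{n=1}^∞ (p(n)|(Δu)(n)|² + q(n)|u(n)|²) < ∞ and for every m with 1 ≤ m ≤ N, one has |u(m)| ≤ C_N · ‖u‖. -/
/-- The `n`-th term of the squared left-definite norm, indexed from `n = 0`. -/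
noncomputable def leftDefiniteTerm (p q : ℕ → ℝ) (u : ℕ → ℂ) (n : ℕ) : ℝ :=
  p (n + 1) * ‖u (n + 2) - u (n + 1)‖ ^ 2 + q (n + 1) * ‖u (n + 1)‖ ^ 2

/-- Evaluation at `m` is bounded with respect to the left-definite norm. -/
def BoundedEvaluation (p q : ℕ → ℝ) (m : ℕ) : Prop :=
  ∃ C : ℝ, 0 < C ∧ ∀ u : ℕ → ℂ, Summable (leftDefiniteTerm p q u) →
    ‖u m‖ ≤ C * Real.sqrt (∑' n, leftDefiniteTerm p q u n)

theorem le_inv_sqrt_mul_sqrt {c x S : ℝ} (hc : 0 < c) (h : c * x ^ 2 ≤ S) :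
    x ≤ (Real.sqrt c)⁻¹ * Real.sqrt S := by
  rw [inv_mul_eq_div, ← Real.sqrt_div' S hc.le]
  exact Real.le_sqrt_of_sq_le (by rwa [le_div_iff₀' hc])

section

variable {p q : ℕ → ℝ}

theorem leftDefiniteTerm_le_tsum (hp : ∀ n, 0 < p n) (hq : ∀ n, 0 ≤ q n) {u : ℕ → ℂ}
    (hu : Summable (leftDefiniteTerm p q u)) (n : ℕ) :
    leftDefiniteTerm p q u n ≤ ∑' i, leftDefiniteTerm p q u i :=
  hu.le_tsum n fun _ _ =>
    add_nonneg (mul_nonneg (hp _).le (sq_nonneg _)) (mul_nonneg (hq _) (sq_nonneg _))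

theorem norm_sub_le_of_summable (hp : ∀ n, 0 < p n) (hq : ∀ n, 0 ≤ q n) {u : ℕ → ℂ}
    (hu : Summable (leftDefiniteTerm p q u)) (n : ℕ) :
    ‖u (n + 2) - u (n + 1)‖ ≤
      (Real.sqrt (p (n + 1)))⁻¹ * Real.sqrt (∑' i, leftDefiniteTerm p q u i) :=
  le_inv_sqrt_mul_sqrt (hp _) <|
    (le_add_of_nonneg_right (mul_nonneg (hq _) (sq_nonneg _))).trans
      (leftDefiniteTerm_le_tsum hp hq hu n)

theorem boundedEvaluation_of_pos (hp : ∀ n, 0 < p n) (hq : ∀ n, 0 ≤ q n) {n : ℕ}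
    (hn : 0 < q (n + 1)) : BoundedEvaluation p q (n + 1) :=
  ⟨(Real.sqrt (q (n + 1)))⁻¹, inv_pos.2 (Real.sqrt_pos.2 hn), fun _ hu =>
    le_inv_sqrt_mul_sqrt hn <|
      (le_add_of_nonneg_left (mul_nonneg (hp _).le (sq_nonneg _))).trans
        (leftDefiniteTerm_le_tsum hp hq hu n)⟩

theorem boundedEvaluation_succ_iff (hp : ∀ n, 0 < p n) (hq : ∀ n, 0 ≤ q n) (n : ℕ) :
    BoundedEvaluation p q (n + 2) ↔ BoundedEvaluation p q (n + 1) := by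
  have hpos : 0 < (Real.sqrt (p (n + 1)))⁻¹ := inv_pos.2 (Real.sqrt_pos.2 (hp _))
  constructor
  · rintro ⟨C, hC, h⟩
    refine ⟨C + (Real.sqrt (p (n + 1)))⁻¹, add_pos hC hpos, fun u hu => ?_⟩
    rw [add_mul]
    exact (norm_le_norm_add_norm_sub (u (n + 2)) (u (n + 1))).trans
      (add_le_add (h u hu) (norm_sub_le_of_summable hp hq hu n))
  · rintro ⟨C, hC, h⟩
    refine ⟨C + (Real.sqrt (p (n + 1)))⁻¹, add_pos hC hpos, fun u hu => ?_⟩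
    rw [add_mul]
    exact (norm_le_norm_add_norm_sub' (u (n + 2)) (u (n + 1))).trans
      (add_le_add (h u hu) (norm_sub_le_of_summable hp hq hu n))

theorem boundedEvaluation_iff_one (hp : ∀ n, 0 < p n) (hq : ∀ n, 0 ≤ q n) (n : ℕ) :
    BoundedEvaluation p q (n + 1) ↔ BoundedEvaluation p q 1 := by
  induction n with
  | zero => rfl
  | succ n ih => exact (boundedEvaluation_succ_iff hp hq n).trans ih

end


/-- Lemma 2.1 of the paper: if `p > 0`, `q ≥ 0` and `q(k) > 0` for some `k ≥ 1`, then for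
every `N ≥ 1` there is a constant `C_N > 0` such that `|u(m)| ≤ C_N ‖u‖_{H₁}` for all
`u ∈ H₁` and all `1 ≤ m ≤ N`, where
`‖u‖_{H₁}² = ∑_{n=1}^∞ (p(n)|(Δu)(n)|² + q(n)|u(n)|²)`. -/
theorem pointwise_bound_by_H1_norm (p : ℕ → ℝ) (hp : ∀ l, 0 < p l)
    (q : ℕ → ℝ) (hq : ∀ n, 0 ≤ q n) (hq0 : ∃ k, 1 ≤ k ∧ 0 < q k)
    (N : ℕ) (hN : 1 ≤ N) :
    ∃ C : ℝ, 0 < C ∧ ∀ u : ℕ → ℂ,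
      Summable (fun n : ℕ =>
        p (n + 1) * ‖u (n + 2) - u (n + 1)‖ ^ 2 + q (n + 1) * ‖u (n + 1)‖ ^ 2) →
      ∀ m, 1 ≤ m → m ≤ N →
        ‖u m‖ ≤ C * Real.sqrt (∑' n : ℕ,
          (p (n + 1) * ‖u (n + 2) - u (n + 1)‖ ^ 2 + q (n + 1) * ‖u (n + 1)‖ ^ 2)) := by
  obtain ⟨k, hk, hqk⟩ := hq0
  obtain ⟨k, rfl⟩ := Nat.exists_eq_add_of_le' hk
  have hone : BoundedEvaluation p q 1 :=
    (boundedEvaluation_iff_one hp hq k).1 (boundedEvaluation_of_pos hp hq hqk)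
  choose C hC hbound using fun n => (boundedEvaluation_iff_one hp hq n).2 hone
  refine ⟨∑ n ∈ Finset.range N, C n,
    Finset.sum_pos (fun n _ => hC n) (Finset.nonempty_range_iff.2 (by omega)),
    fun u hu m hm hmN => ?_⟩
  obtain ⟨m, rfl⟩ := Nat.exists_eq_add_of_le' hm
  refine (hbound m u hu).trans (mul_le_mul_of_nonneg_right ?_ (Real.sqrt_nonneg _))
  exact Finset.single_le_sum (fun n _ => (hC n).le) (Finset.mem_range.2 hmN)
end

section
/- Let p : ℕ → ℝ be strictly positive and let q : ℕ → ℝ be nonnegative and not identically zero on the positive integers. Let (u_k)_{k∈ℕ} be a sequence of elements of the left-definite space H₁ that is Cauchy with respect to the norm ‖u‖ = (∑_{n=1}^∞ (p(n)|(Δu)(n)|² + q(n)|u(n)|²))^{1/2}. Then for each n ≥ 1 the pointwise limit u(n) = lim_{k→∞} u_k(n) exists in ℂ, and the sequence n ↦ √(q(n))·u_k(n) converges to n ↦ √(q(n))·u(n) in ℓ²(ℕ) as k → ∞. -/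
/-- `u` belongs to the left-definite space `H₁`:
`∑_{n=1}^∞ (p(n)|(Δu)(n)|² + q(n)|u(n)|²) < ∞`. -/
def memH1 (p q : ℕ → ℝ) (u : ℕ → ℂ) : Prop :=
  Summable (fun n : ℕ =>
    p (n + 1) * ‖u (n + 2) - u (n + 1)‖ ^ 2 + q (n + 1) * ‖u (n + 1)‖ ^ 2)

/-- The `H₁`-distance `d(u,v) = (∑_{n=1}^∞ (p(n)|(Δ(u−v))(n)|² + q(n)|u(n)−v(n)|²))^{1/2}`. -/
noncomputable def distH1 (p q : ℕ → ℝ) (u v : ℕ → ℂ) : ℝ :=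
  Real.sqrt (∑' n : ℕ,
    (p (n + 1) * ‖(u (n + 2) - v (n + 2)) - (u (n + 1) - v (n + 1))‖ ^ 2
      + q (n + 1) * ‖u (n + 1) - v (n + 1)‖ ^ 2))

theorem summable_mul_norm_sub_sq {ι E : Type*} [SeminormedAddCommGroup E]
    {w : ι → ℝ} (hw : ∀ i, 0 ≤ w i) {a b : ι → E}
    (ha : Summable fun i => w i * ‖a i‖ ^ 2) (hb : Summable fun i => w i * ‖b i‖ ^ 2) :
    Summable fun i => w i * ‖a i - b i‖ ^ 2 := by
  refine Summable.of_nonneg_of_le (fun i => mul_nonneg (hw i) (sq_nonneg _)) (fun i => ?_)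
    ((ha.add hb).mul_left 2)
  have h : ‖a i - b i‖ ^ 2 ≤ 2 * (‖a i‖ ^ 2 + ‖b i‖ ^ 2) := by
    have h1 := norm_sub_le (a i) (b i)
    nlinarith [sq_nonneg (‖a i‖ - ‖b i‖), norm_nonneg (a i - b i)]
  nlinarith [mul_le_mul_of_nonneg_left h (hw i)]

theorem memH1.summable_sub {p q : ℕ → ℝ} (hp : ∀ n, 0 ≤ p n) (hq : ∀ n, 0 ≤ q n)
    {u v : ℕ → ℂ} (hu : memH1 p q u) (hv : memH1 p q v) :
    Summable fun n : ℕ =>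
      p (n + 1) * ‖(u (n + 2) - v (n + 2)) - (u (n + 1) - v (n + 1))‖ ^ 2
        + q (n + 1) * ‖u (n + 1) - v (n + 1)‖ ^ 2 := by
  have hP : ∀ {w : ℕ → ℂ}, memH1 p q w →
      Summable fun n : ℕ => p (n + 1) * ‖w (n + 2) - w (n + 1)‖ ^ 2 := fun hw =>
    Summable.of_nonneg_of_le (fun n => mul_nonneg (hp _) (sq_nonneg _))
      (fun n => le_add_of_nonneg_right (mul_nonneg (hq _) (sq_nonneg _))) hw
  have hQ : ∀ {w : ℕ → ℂ}, memH1 p q w →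
      Summable fun n : ℕ => q (n + 1) * ‖w (n + 1)‖ ^ 2 := fun hw =>
    Summable.of_nonneg_of_le (fun n => mul_nonneg (hq _) (sq_nonneg _))
      (fun n => le_add_of_nonneg_left (mul_nonneg (hp _) (sq_nonneg _))) hw
  refine Summable.add ?_
    (summable_mul_norm_sub_sq (fun n => hq (n + 1)) (hQ hu) (hQ hv))
  simpa only [sub_sub_sub_comm] using
    summable_mul_norm_sub_sq (fun n => hp (n + 1)) (hP hu) (hP hv)

theorem sum_le_distH1_sq {p q : ℕ → ℝ} (hp : ∀ n, 0 ≤ p n) (hq : ∀ n, 0 ≤ q n)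
    {u v : ℕ → ℂ} (hu : memH1 p q u) (hv : memH1 p q v) (s : Finset ℕ) :
    ∑ n ∈ s, (p (n + 1) * ‖(u (n + 2) - v (n + 2)) - (u (n + 1) - v (n + 1))‖ ^ 2
        + q (n + 1) * ‖u (n + 1) - v (n + 1)‖ ^ 2) ≤ distH1 p q u v ^ 2 := by
  have h0 : ∀ n : ℕ,
      0 ≤ p (n + 1) * ‖(u (n + 2) - v (n + 2)) - (u (n + 1) - v (n + 1))‖ ^ 2
        + q (n + 1) * ‖u (n + 1) - v (n + 1)‖ ^ 2 := fun n =>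
    add_nonneg (mul_nonneg (hp _) (sq_nonneg _)) (mul_nonneg (hq _) (sq_nonneg _))
  rw [distH1, Real.sq_sqrt (tsum_nonneg h0)]
  exact (hu.summable_sub hp hq hv).sum_le_tsum s fun n _ => h0 n

theorem cauchySeq_of_mul_norm_sq_le {E : Type*} [SeminormedAddCommGroup E] {f : ℕ → E}
    {c : ℝ} (hc : 0 < c) {d : ℕ → ℕ → ℝ}
    (hd : ∀ ε : ℝ, 0 < ε → ∃ K : ℕ, ∀ j, K ≤ j → ∀ k, K ≤ k → d j k < ε)
    (hd0 : ∀ j k, 0 ≤ d j k) (h : ∀ j k, c * ‖f j - f k‖ ^ 2 ≤ d j k ^ 2) :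
    CauchySeq f := by
  refine Metric.cauchySeq_iff.2 fun ε hε => ?_
  obtain ⟨K, hK⟩ := hd (√c * ε) (mul_pos (Real.sqrt_pos.2 hc) hε)
  refine ⟨K, fun j hj k hk => ?_⟩
  rw [dist_eq_norm]
  refine lt_of_mul_lt_mul_left (lt_of_le_of_lt ?_ (hK j hj k hk)) (Real.sqrt_nonneg c)
  refine (pow_le_pow_iff_left₀ (by positivity) (hd0 j k) two_ne_zero).1 ?_
  rw [mul_pow, Real.sq_sqrt hc.le]
  exact h j k

/-- A sequence that is Cauchy in `H₁` is Cauchy at every positive integer. -/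
theorem cauchySeq_apply_of_cauchy_distH1 {p q : ℕ → ℝ} (hp : ∀ n, 0 < p n)
    (hq : ∀ n, 0 ≤ q n) (hq0 : ∃ k, 1 ≤ k ∧ 0 < q k) {u : ℕ → ℕ → ℂ}
    (hmem : ∀ k, memH1 p q (u k))
    (hcauchy : ∀ ε : ℝ, 0 < ε → ∃ K : ℕ, ∀ j, K ≤ j → ∀ k, K ≤ k →
      distH1 p q (u j) (u k) < ε) (n : ℕ) :
    CauchySeq fun k => u k (n + 1) := by
  have hterm := fun j k m => by
    simpa only [Finset.sum_singleton] using
      sum_le_distH1_sq (fun n => (hp n).le) hq (hmem j) (hmem k) {m}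
  have hdiff : ∀ m, CauchySeq fun k => u k (m + 2) - u k (m + 1) := fun m =>
    cauchySeq_of_mul_norm_sq_le (hp (m + 1)) hcauchy (fun _ _ => Real.sqrt_nonneg _)
      fun j k => by
        rw [sub_sub_sub_comm]
        exact (le_add_of_nonneg_right (mul_nonneg (hq _) (sq_nonneg _))).trans (hterm j k m)
  have hstep : ∀ m, (CauchySeq fun k => u k (m + 1)) ↔ CauchySeq fun k => u k (m + 2) :=
    fun m => ⟨fun h => by simpa [Pi.add_def] using h.add (hdiff m),
      fun h => by simpa [Pi.add_def, Pi.neg_def] using h.add (hdiff m).neg⟩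
  have hall : ∀ m, (CauchySeq fun k => u k 1) ↔ CauchySeq fun k => u k (m + 1) := by
    intro m
    induction m with
    | zero => rfl
    | succ m ih => exact ih.trans (hstep m)
  obtain ⟨k₀, hk₀, hqk₀⟩ := hq0
  obtain ⟨m, rfl⟩ := Nat.exists_eq_add_of_le' hk₀
  refine (hall n).1 ((hall m).2 ?_)
  exact cauchySeq_of_mul_norm_sq_le hqk₀ hcauchy (fun _ _ => Real.sqrt_nonneg _)
    fun j k => (le_add_of_nonneg_left (mul_nonneg (hp _).le (sq_nonneg _))).trans (hterm j k m)

/-- Lemma (Cauchy sequences, part 2): if `(u_k)` is Cauchy in `H₁`, then the pointwise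
limits `u(n) = lim_k u_k(n)` exist for all `n ≥ 1`, and `n ↦ √(q(n)) u_k(n)` converges to
`n ↦ √(q(n)) u(n)` in `ℓ²(ℕ)` as `k → ∞`. -/
theorem cauchy_implies_pointwise_and_weighted_l2_limit (p : ℕ → ℝ) (hp : ∀ l, 0 < p l)
    (q : ℕ → ℝ) (hq : ∀ n, 0 ≤ q n) (hq0 : ∃ k, 1 ≤ k ∧ 0 < q k)
    (u : ℕ → ℕ → ℂ)
    (hmem : ∀ k, memH1 p q (u k))
    (hcauchy : ∀ ε : ℝ, 0 < ε → ∃ K : ℕ, ∀ j, K ≤ j → ∀ k, K ≤ k →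
      distH1 p q (u j) (u k) < ε) :
    ∃ ulim : ℕ → ℂ,
      (∀ n, 1 ≤ n →
        Filter.Tendsto (fun k : ℕ => u k n) Filter.atTop (nhds (ulim n))) ∧
      Filter.Tendsto
        (fun k : ℕ => ∑' n : ℕ,
          ‖(Real.sqrt (q (n + 1)) : ℂ) * u k (n + 1)
            - (Real.sqrt (q (n + 1)) : ℂ) * ulim (n + 1)‖ ^ 2)
        Filter.atTop (nhds 0) := by
  choose l hl using fun n => cauchySeq_tendsto_of_complete
    (cauchySeq_apply_of_cauchy_distH1 hp hq hq0 hmem hcauchy n)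
  refine ⟨fun n => l (n - 1), fun n hn => ?_, ?_⟩
  · obtain ⟨m, rfl⟩ := Nat.exists_eq_add_of_le' hn
    exact hl m
  have hnorm : ∀ n (a b : ℂ),
      ‖(Real.sqrt (q (n + 1)) : ℂ) * a - (Real.sqrt (q (n + 1)) : ℂ) * b‖ ^ 2
        = q (n + 1) * ‖a - b‖ ^ 2 := fun n a b => by
    rw [← mul_sub, norm_mul, mul_pow, Complex.norm_real, Real.norm_eq_abs, sq_abs,
      Real.sq_sqrt (hq _)]
  simp only [hnorm, Nat.add_sub_cancel]
  have h0 : ∀ k n, 0 ≤ q (n + 1) * ‖u k (n + 1) - l n‖ ^ 2 := fun k n =>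
    mul_nonneg (hq _) (sq_nonneg _)
  refine Metric.tendsto_atTop.2 fun ε hε => ?_
  obtain ⟨K, hK⟩ := hcauchy (√(ε / 2)) (Real.sqrt_pos.2 (half_pos hε))
  refine ⟨K, fun j hj => ?_⟩
  rw [Real.dist_0_eq_abs, abs_of_nonneg (tsum_nonneg (h0 j))]
  refine (Real.tsum_le_of_sum_range_le (h0 j) fun N => ?_).trans_lt (half_lt_self hε)
  refine le_of_tendsto (tendsto_finsetSum _ fun n _ =>
    (((tendsto_const_nhds (x := u j (n + 1))).sub (hl n)).norm.pow 2).const_mul (q (n + 1)))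
    (Filter.eventually_atTop.2 ⟨K, fun k hk => ?_⟩)
  calc ∑ n ∈ Finset.range N, q (n + 1) * ‖u j (n + 1) - u k (n + 1)‖ ^ 2
      ≤ _ := Finset.sum_le_sum fun n _ =>
        le_add_of_nonneg_left (mul_nonneg (hp (n + 1)).le (sq_nonneg _))
    _ ≤ distH1 p q (u j) (u k) ^ 2 :=
        sum_le_distH1_sq (fun n => (hp n).le) hq (hmem j) (hmem k) (Finset.range N)
    _ ≤ √(ε / 2) ^ 2 := pow_le_pow_left₀ (Real.sqrt_nonneg _) (hK j hj k hk).le 2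
    _ = ε / 2 := Real.sq_sqrt (half_pos hε).le
end
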